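/- Let a, m, λ_P, λ_r > 0 and define g(s,r) = 2 λ_P ( ∫₀^{r+a} e^{m Ā(r,a,x)(s−1)} dx − (r+a) ), Φ(s) = ∫₀^∞ e^{g(s, t/2)} f_L(t) dt, and κ(r,k) = 2 λ_P (m β̄(r))^k (r + a − β(r)·k/(k+1)). Then Φ is twice differentiable at s = 1 and Φ''(1) = ∫₀^∞ ( κ(t/2,1)² + κ(t/2,2) ) f_L(t) dt; consequently the variance of the typical-RSU load in the platooned scenario equals Φ''(1) + m λ_P/λ_r − (m λ_P/λ_r)². -/

import Mathlib

open MeasureTheory Real intervalIntegral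

/-- `A r a x` : length of the intersection of two 1D intervals of radii `r` and `a`
whose centers are at distance `x`. -/
noncomputable def interLen (r a x : ℝ) : ℝ :=
  if x ≤ |r - a| then 2 * min r a else if x ≤ r + a then r + a - x else 0

/-- Exponent of the PGF of the number of points of a 1D Matérn cluster process in an
interval of radius `r`. -/
noncomputable def gExp (lamP m a s r : ℝ) : ℝ :=
  2 * lamP * ((∫ x in (0:ℝ)..(r + a),
      Real.exp (m * (interLen r a x / (2 * a)) * (s - 1))) - (r + a))

/-- PGF of the load on the typical RSU in the platooned traffic scenario. -/
noncomputable def pgfTypicalPTS (lamP m a lamr s : ℝ) : ℝ :=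
  ∫ t in Set.Ioi (0 : ℝ),
    Real.exp (gExp lamP m a s (t / 2)) * (4 * lamr ^ 2 * t * Real.exp (-2 * lamr * t))

/-- `κ(r,k) = 2 λ_P (m β̄(r))^k (r + a − β(r) k/(k+1))`. -/
noncomputable def kappa (lamP m a r : ℝ) (k : ℕ) : ℝ :=
  2 * lamP * (m * (min r a / a)) ^ k * (r + a - 2 * min r a * (k : ℝ) / ((k : ℝ) + 1))

/-- Scaled overlap `m · Ā`, as a jointly continuous function. -/
noncomputable def bB (m a r x : ℝ) : ℝ := m * (min (2 * min r a) (r + a - x) / (2 * a))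

/-- `k`-th `s`-derivative of the inner integral. -/
noncomputable def gG (m a : ℝ) (k : ℕ) (s r : ℝ) : ℝ :=
  ∫ x in (0:ℝ)..(r + a), bB m a r x ^ k * Real.exp (bB m a r x * (s - 1))

lemma bB_continuous (m a : ℝ) : Continuous (fun p : ℝ × ℝ => bB m a p.1 p.2) := by
  unfold bB; fun_prop

lemma bB_nonneg {m a r x : ℝ} (ha : 0 < a) (hm : 0 < m) (hr : 0 ≤ r) (hx : x ≤ r + a) :
    0 ≤ bB m a r x := by
  unfold bB
  have : 0 ≤ min (2 * min r a) (r + a - x) :=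
    le_min (mul_nonneg (by norm_num) (le_min hr ha.le)) (by linarith)
  positivity

lemma bB_le {m a r x : ℝ} (ha : 0 < a) (hm : 0 < m) : bB m a r x ≤ m := by
  unfold bB
  have h1 : min (2 * min r a) (r + a - x) ≤ 2 * a :=
    (min_le_left _ _).trans (by linarith [min_le_right r a])
  have : min (2 * min r a) (r + a - x) / (2 * a) ≤ 1 := (div_le_one (by positivity)).2 h1
  nlinarith

lemma interLen_eq {a r x : ℝ} (hx : x ≤ r + a) :
    interLen r a x = min (2 * min r a) (r + a - x) := by
  unfold interLen
  have key : |r - a| = r + a - 2 * min r a := by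
    rcases le_total r a with h | h
    · rw [min_eq_left h, abs_of_nonpos (by linarith)]; ring
    · rw [min_eq_right h, abs_of_nonneg (by linarith)]; ring
  rw [key, if_pos hx]
  split_ifs with h
  · exact (min_eq_left (by linarith)).symm
  · exact (min_eq_right (by linarith)).symm

lemma gExp_eq {lamP m a s r : ℝ} (ha : 0 < a) (hr : 0 ≤ r) :
    gExp lamP m a s r = 2 * lamP * (gG m a 0 s r - (r + a)) := by
  unfold gExp gG
  congr 2
  apply intervalIntegral.integral_congr
  intro x hx
  rw [Set.uIcc_of_le (by linarith)] at hx
  simp only [interLen_eq hx.2, bB, pow_zero, one_mul]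

lemma gG_continuous (m a : ℝ) (k : ℕ) (s : ℝ) : Continuous (fun r => gG m a k s r) := by
  unfold gG
  apply intervalIntegral.continuous_parametric_intervalIntegral_of_continuous
  · have := bB_continuous m a
    unfold Function.uncurry
    fun_prop
  · fun_prop

lemma exp_bound {b m d s : ℝ} (hb : 0 ≤ b) (hbm : b ≤ m) (hs : |s - 1| ≤ d) :
    Real.exp (b * (s - 1)) ≤ Real.exp (m * d) := by
  apply Real.exp_le_exp.2
  have h1 : b * (s - 1) ≤ b * d := mul_le_mul_of_nonneg_left ((le_abs_self _).trans hs) hb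
  have h2 : b * d ≤ m * d := mul_le_mul_of_nonneg_right hbm ((abs_nonneg _).trans hs)
  linarith

lemma integrand_bound {m a d s r x : ℝ} (k : ℕ) (ha : 0 < a) (hm : 0 < m) (hr : 0 ≤ r)
    (hx : x ≤ r + a) (hs : |s - 1| ≤ d) :
    ‖bB m a r x ^ k * Real.exp (bB m a r x * (s - 1))‖ ≤ m ^ k * Real.exp (m * d) := by
  have h0 := bB_nonneg ha hm hr hx
  have h1 : bB m a r x ≤ m := bB_le ha hm
  rw [Real.norm_of_nonneg (by positivity)]
  exact mul_le_mul (pow_le_pow_left₀ h0 h1 k) (exp_bound h0 h1 hs) (by positivity) (by positivity)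

lemma gG_bound {m a d s r : ℝ} (k : ℕ) (ha : 0 < a) (hm : 0 < m) (hr : 0 ≤ r)
    (hs : |s - 1| ≤ d) : |gG m a k s r| ≤ m ^ k * Real.exp (m * d) * (r + a) := by
  have := intervalIntegral.norm_integral_le_of_norm_le_const (a := 0) (b := r + a)
    (f := fun x => bB m a r x ^ k * Real.exp (bB m a r x * (s - 1)))
    (C := m ^ k * Real.exp (m * d)) (by
      intro x hx
      rw [Set.uIoc_of_le (by linarith)] at hx
      exact integrand_bound k ha hm hr hx.2 hs)
  rw [sub_zero, abs_of_nonneg (show 0 ≤ r + a by linarith)] at this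
  exact this

lemma gG_hasDerivAt {m a r : ℝ} (k : ℕ) (s : ℝ) (ha : 0 < a) (hm : 0 < m) (hr : 0 ≤ r) :
    HasDerivAt (fun s => gG m a k s r) (gG m a (k + 1) s r) s := by
  unfold gG
  have hc : ∀ (j : ℕ) (s : ℝ),
      Continuous (fun x => bB m a r x ^ j * Real.exp (bB m a r x * (s - 1))) := by
    intro j s
    have h : Continuous (fun x => bB m a r x) :=
      (bB_continuous m a).comp (Continuous.prodMk_right r)
    fun_prop
  refine (intervalIntegral.hasDerivAt_integral_of_dominated_loc_of_deriv_le
    (F := fun s x => bB m a r x ^ k * Real.exp (bB m a r x * (s - 1)))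
    (F' := fun s x => bB m a r x ^ (k+1) * Real.exp (bB m a r x * (s - 1)))
    (s := Metric.ball s 1) (bound := fun _ => m ^ (k+1) * Real.exp (m * (|s - 1| + 1)))
    (Metric.ball_mem_nhds s one_pos) ?_ ?_ ?_ ?_ ?_ ?_).2
  · exact Filter.Eventually.of_forall fun y => (hc k y).aestronglyMeasurable
  · exact (hc k s).intervalIntegrable _ _
  · exact (hc (k+1) s).aestronglyMeasurable
  · refine Filter.Eventually.of_forall fun x hx y hy => ?_
    rw [Set.uIoc_of_le (by linarith)] at hx
    refine integrand_bound (k+1) ha hm hr hx.2 ?_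
    rw [Metric.mem_ball, Real.dist_eq] at hy
    have := abs_sub_le y s 1
    linarith
  · exact intervalIntegrable_const
  · refine Filter.Eventually.of_forall fun x hx y hy => ?_
    have h1 : HasDerivAt (fun y => bB m a r x * (y - 1)) (bB m a r x) y := by
      simpa using ((hasDerivAt_id y).sub_const 1).const_mul (bB m a r x)
    have := (h1.exp).const_mul (bB m a r x ^ k)
    exact this.congr_deriv (by ring)

lemma gG_one {lamP m a r : ℝ} (k : ℕ) (ha : 0 < a) (hr : 0 ≤ r) :
    2 * lamP * gG m a k 1 r = kappa lamP m a r k := by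
  unfold gG kappa bB
  simp only [sub_self, mul_zero, Real.exp_zero, mul_one]
  set q := min r a with hq
  have hq0 : 0 ≤ q := le_min hr ha.le
  have hqu : 2 * q ≤ r + a := by linarith [min_le_left r a, min_le_right r a]
  rw [intervalIntegral.integral_comp_sub_left
    (fun y => (m * (min (2 * q) y / (2 * a))) ^ k) (r + a)]
  simp only [sub_self, sub_zero]
  have hc : Continuous (fun y : ℝ => (m * (min (2 * q) y / (2 * a))) ^ k) := by fun_prop
  rw [← intervalIntegral.integral_add_adjacent_intervals (hc.intervalIntegrable 0 (2*q))
    (hc.intervalIntegrable (2*q) (r+a))]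
  have e1 : ∫ y in (0:ℝ)..(2*q), (m * (min (2 * q) y / (2 * a))) ^ k
      = ∫ y in (0:ℝ)..(2*q), (m / (2*a)) ^ k * y ^ k := by
    apply intervalIntegral.integral_congr
    intro y hy
    rw [Set.uIcc_of_le (by linarith)] at hy
    simp only [min_eq_right hy.2]
    rw [← mul_pow]; congr 1; ring
  have e2 : ∫ y in (2*q)..(r+a), (m * (min (2 * q) y / (2 * a))) ^ k
      = ∫ y in (2*q)..(r+a), (m * (q / a)) ^ k := by
    apply intervalIntegral.integral_congr
    intro y hy
    rw [Set.uIcc_of_le (by linarith)] at hy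
    simp only [min_eq_left hy.1]
    congr 2; field_simp
  rw [e1, e2, intervalIntegral.integral_const_mul, integral_pow, intervalIntegral.integral_const]
  have hk : (k:ℝ) + 1 ≠ 0 := by positivity
  have e3 : (m * (q / a)) ^ k = (m / (2*a)) ^ k * (2 * q) ^ k := by
    rw [← mul_pow]; congr 1; field_simp
  rw [e3, zero_pow (Nat.succ_ne_zero k), smul_eq_mul]
  field_simp
  ring

/-- Exponent near `s = 1`. -/
noncomputable def gE (lamP m a s t : ℝ) : ℝ :=
  2 * lamP * (gG m a 0 s (t / 2) - (t / 2 + a))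

noncomputable def wW (lamr t : ℝ) : ℝ := 4 * lamr ^ 2 * t * Real.exp (-2 * lamr * t)

noncomputable def h0 (lamP m a lamr s t : ℝ) : ℝ :=
  Real.exp (gE lamP m a s t) * wW lamr t

noncomputable def h1 (lamP m a lamr s t : ℝ) : ℝ :=
  (2 * lamP * gG m a 1 s (t / 2)) * Real.exp (gE lamP m a s t) * wW lamr t

noncomputable def h2 (lamP m a lamr s t : ℝ) : ℝ :=
  ((2 * lamP * gG m a 1 s (t / 2)) ^ 2 + 2 * lamP * gG m a 2 s (t / 2))
    * Real.exp (gE lamP m a s t) * wW lamr t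

lemma h_cont (lamP m a lamr s : ℝ) : Continuous (h0 lamP m a lamr s) ∧
    Continuous (h1 lamP m a lamr s) ∧ Continuous (h2 lamP m a lamr s) := by
  have hg : ∀ k, Continuous (fun t : ℝ => gG m a k s (t / 2)) := fun k =>
    (gG_continuous m a k s).comp (continuous_id.div_const 2)
  have := hg 0
  have := hg 1
  have := hg 2
  refine ⟨?_, ?_, ?_⟩
  · unfold h0 gE wW; fun_prop
  · unfold h1 gE wW; fun_prop
  · unfold h2 gE wW; fun_prop

lemma gE_deriv {lamP m a : ℝ} (s t : ℝ) (ha : 0 < a) (hm : 0 < m) (ht : 0 < t) :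
    HasDerivAt (fun s => gE lamP m a s t) (2 * lamP * gG m a 1 s (t / 2)) s := by
  unfold gE
  exact ((gG_hasDerivAt 0 s ha hm (by positivity)).sub_const _).const_mul _

lemma h0_deriv {lamP m a lamr : ℝ} (s t : ℝ) (ha : 0 < a) (hm : 0 < m) (ht : 0 < t) :
    HasDerivAt (fun s => h0 lamP m a lamr s t) (h1 lamP m a lamr s t) s := by
  unfold h0 h1
  exact (((gE_deriv (lamP := lamP) s t ha hm ht).exp).mul_const (wW lamr t)).congr_deriv (by ring)

lemma h1_deriv {lamP m a lamr : ℝ} (s t : ℝ) (ha : 0 < a) (hm : 0 < m) (ht : 0 < t) :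
    HasDerivAt (fun s => h1 lamP m a lamr s t) (h2 lamP m a lamr s t) s := by
  unfold h1 h2
  have hg : HasDerivAt (fun s => 2 * lamP * gG m a 1 s (t / 2))
      (2 * lamP * gG m a 2 s (t / 2)) s :=
    (gG_hasDerivAt 1 s ha hm (by positivity)).const_mul _
  exact ((hg.mul ((gE_deriv (lamP := lamP) s t ha hm ht).exp)).mul_const (wW lamr t)).congr_deriv
    (by ring)

lemma h_bound {lamP m a lamr : ℝ} (ha : 0 < a) (hm : 0 < m) (hP : 0 < lamP) (hr : 0 < lamr) :
    ∃ δ > 0, ∃ K, ∀ s ∈ Metric.ball (1:ℝ) δ, ∀ t, 0 < t →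
      ‖h0 lamP m a lamr s t‖ ≤ K * Real.exp (-lamr * t) ∧
      ‖h1 lamP m a lamr s t‖ ≤ K * Real.exp (-lamr * t) ∧
      ‖h2 lamP m a lamr s t‖ ≤ K * Real.exp (-lamr * t) := by
  set c := lamr / (2 * lamP) with hc
  have hc0 : 0 < c := by positivity
  have hexp : Real.exp (m * (Real.log (1 + c) / m)) = 1 + c := by
    rw [mul_div_cancel₀ _ hm.ne', Real.exp_log (by positivity)]
  set M := 2 * lamP * (1 + c) * (m + m ^ 2) with hM
  have hM0 : 0 < M := by positivity
  set η := lamr / 3 with hη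
  have hη0 : 0 < η := by positivity
  refine ⟨Real.log (1 + c) / m, div_pos (Real.log_pos (by linarith)) hm,
    8 * lamr ^ 2 * ((1 + M / η) ^ 2 / η) * Real.exp (4 * lamr * a), ?_⟩
  intro s hs t ht
  rw [Metric.mem_ball, Real.dist_eq] at hs
  have hb := fun k => gG_bound (m := m) (a := a) (r := t / 2) k ha hm (by positivity) hs.le
  simp only [hexp] at hb
  set u := t / 2 + a with hu
  have hu0 : 0 < u := by positivity
  have hE1 : gE lamP m a s t ≤ lamr * u := by
    have h := (le_abs_self _).trans (hb 0)
    unfold gE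
    have h' : gG m a 0 s (t / 2) - u ≤ c * u := by
      rw [pow_zero, one_mul] at h; linarith
    calc _ ≤ 2 * lamP * (c * u) := mul_le_mul_of_nonneg_left h' (by positivity)
      _ = lamr * u := by rw [hc]; field_simp
  have hg1 : |2 * lamP * gG m a 1 s (t / 2)| ≤ M * u := by
    rw [abs_mul, abs_of_pos (show 0 < 2 * lamP by positivity)]
    calc _ ≤ 2 * lamP * (m ^ 1 * (1 + c) * u) := mul_le_mul_of_nonneg_left (hb 1) (by positivity)
      _ ≤ 2 * lamP * (m ^ 1 * (1 + c) * u) + 2 * lamP * (m ^ 2 * (1 + c) * u) :=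
        le_add_of_nonneg_right (by positivity)
      _ = M * u := by rw [hM]; ring
  have hg2 : |2 * lamP * gG m a 2 s (t / 2)| ≤ M * u := by
    rw [abs_mul, abs_of_pos (show 0 < 2 * lamP by positivity)]
    calc _ ≤ 2 * lamP * (m ^ 2 * (1 + c) * u) := mul_le_mul_of_nonneg_left (hb 2) (by positivity)
      _ ≤ 2 * lamP * (m ^ 2 * (1 + c) * u) + 2 * lamP * (m ^ 1 * (1 + c) * u) :=
        le_add_of_nonneg_right (by positivity)
      _ = M * u := by rw [hM]; ring
  have hw0 : 0 ≤ wW lamr t := by unfold wW; positivity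
  have hwu : wW lamr t ≤ 8 * lamr ^ 2 * u * (Real.exp (4 * lamr * a) * Real.exp (-4 * lamr * u)) := by
    unfold wW
    rw [← Real.exp_add, show 4 * lamr * a + -4 * lamr * u = -2 * lamr * t by rw [hu]; ring]
    apply mul_le_mul_of_nonneg_right _ (Real.exp_pos _).le
    have : t ≤ 2 * u := by rw [hu]; linarith
    nlinarith [sq_nonneg lamr]
  -- main estimate
  have hmain : ∀ p : ℝ, |p| ≤ (1 + M * u) ^ 2 →
      ‖p * Real.exp (gE lamP m a s t) * wW lamr t‖ ≤
      8 * lamr ^ 2 * ((1 + M / η) ^ 2 / η) * Real.exp (4 * lamr * a) * Real.exp (-lamr * t) := by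
    intro p hp
    rw [norm_mul, norm_mul, Real.norm_eq_abs, Real.norm_of_nonneg (Real.exp_pos _).le,
      Real.norm_of_nonneg hw0]
    set E := Real.exp (η * u) with hEd
    have hE : 1 ≤ E := Real.one_le_exp (by positivity)
    have hηE : η * u ≤ E := by linarith [Real.add_one_le_exp (η * u)]
    have hue : u ≤ E / η := by rw [le_div_iff₀ hη0]; linarith
    have hMu : 1 + M * u ≤ (1 + M / η) * E := by
      have : M * u ≤ M * (E / η) := mul_le_mul_of_nonneg_left hue hM0.le
      calc 1 + M * u ≤ E + M * (E / η) := by linarith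
        _ = _ := by ring
    calc |p| * Real.exp (gE lamP m a s t) * wW lamr t
        ≤ ((1 + M / η) * E) ^ 2 * Real.exp (lamr * u) *
          (8 * lamr ^ 2 * (E / η) * (Real.exp (4 * lamr * a) * Real.exp (-4 * lamr * u))) := by
          apply mul_le_mul _ _ hw0 (by positivity)
          · apply mul_le_mul _ (Real.exp_le_exp.2 hE1) (by positivity) (by positivity)
            exact hp.trans (pow_le_pow_left₀ (by positivity) hMu 2)
          · refine hwu.trans ?_
            gcongr
      _ = 8 * lamr ^ 2 * ((1 + M / η) ^ 2 / η) * Real.exp (4 * lamr * a) *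
          (E ^ 3 * Real.exp (lamr * u) * Real.exp (-4 * lamr * u)) := by ring
      _ ≤ _ := by
          apply mul_le_mul_of_nonneg_left _ (by positivity)
          rw [hEd, ← Real.exp_nat_mul, ← Real.exp_add, ← Real.exp_add]
          apply Real.exp_le_exp.2
          rw [hη, hu]; push_cast
          nlinarith [mul_pos hr ha]
  have hMu0 : 0 < M * u := by positivity
  have q1 : (1:ℝ) + M * u + (M * u) ^ 2 ≤ (1 + M * u) ^ 2 := by
    have : (1 + M * u) ^ 2 = 1 + M * u + (M * u) ^ 2 + M * u := by ring
    linarith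
  have q2 : 0 ≤ (M * u) ^ 2 := by positivity
  refine ⟨?_, ?_, ?_⟩
  · have := hmain 1 (by rw [abs_one]; linarith)
    rwa [one_mul] at this
  · exact hmain _ (hg1.trans (by linarith))
  · refine hmain _ ((abs_add_le _ _).trans ?_)
    rw [abs_pow]
    have := pow_le_pow_left₀ (abs_nonneg _) hg1 2
    linarith

/-- The PGF of the typical-RSU load in the platooned scenario is twice differentiable at
`s = 1`, and its second derivative there is `∫₀^∞ (κ(t/2,1)² + κ(t/2,2)) f_L(t) dt`. -/
theorem second_deriv_pgf_typical_pts (a m lamP lamr : ℝ)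
    (ha : 0 < a) (hm : 0 < m) (hlamP : 0 < lamP) (hlamr : 0 < lamr) :
    DifferentiableAt ℝ (fun s => pgfTypicalPTS lamP m a lamr s) 1
    ∧ HasDerivAt (deriv (fun s => pgfTypicalPTS lamP m a lamr s))
        (∫ t in Set.Ioi (0 : ℝ),
          ((kappa lamP m a (t / 2) 1) ^ 2 + kappa lamP m a (t / 2) 2)
            * (4 * lamr ^ 2 * t * Real.exp (-2 * lamr * t))) 1 := by
  have hΦ : (fun s => pgfTypicalPTS lamP m a lamr s) =
      fun s => ∫ t in Set.Ioi (0:ℝ), h0 lamP m a lamr s t := by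
    funext s
    unfold pgfTypicalPTS
    apply setIntegral_congr_fun measurableSet_Ioi
    intro t ht
    have ht' : (0:ℝ) < t := ht
    simp only [h0, gE, wW, gExp_eq (lamP := lamP) (m := m) (s := s) ha
      (show 0 ≤ t / 2 by positivity)]
  obtain ⟨δ, hδ, K, hK⟩ := h_bound (lamr := lamr) ha hm hlamP hlamr
  have hbi : IntegrableOn (fun t => K * Real.exp (-lamr * t)) (Set.Ioi 0) :=
    (exp_neg_integrableOn_Ioi 0 hlamr).const_mul K
  have hint : ∀ f : ℝ → ℝ, Continuous f →
      (∀ t, 0 < t → ‖f t‖ ≤ K * Real.exp (-lamr * t)) → IntegrableOn f (Set.Ioi 0) := by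
    intro f hf hfb
    refine Integrable.mono' hbi hf.aestronglyMeasurable ?_
    exact (ae_restrict_iff' measurableSet_Ioi).2 (Filter.Eventually.of_forall fun t ht => hfb t ht)
  have hd0 : ∀ s ∈ Metric.ball (1:ℝ) δ,
      HasDerivAt (fun s => ∫ t in Set.Ioi (0:ℝ), h0 lamP m a lamr s t)
        (∫ t in Set.Ioi (0:ℝ), h1 lamP m a lamr s t) s := by
    intro s hs
    refine (hasDerivAt_integral_of_dominated_loc_of_deriv_le
      (Metric.isOpen_ball.mem_nhds hs) ?_ ?_ ?_ ?_ hbi ?_).2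
    · exact Filter.Eventually.of_forall fun y => (h_cont lamP m a lamr y).1.aestronglyMeasurable
    · exact hint _ (h_cont lamP m a lamr s).1 fun t ht => (hK s hs t ht).1
    · exact (h_cont lamP m a lamr s).2.1.aestronglyMeasurable
    · exact (ae_restrict_iff' measurableSet_Ioi).2
        (Filter.Eventually.of_forall fun t ht y hy => (hK y hy t ht).2.1)
    · exact (ae_restrict_iff' measurableSet_Ioi).2
        (Filter.Eventually.of_forall fun t ht y _ => h0_deriv y t ha hm ht)
  have h1m : (1:ℝ) ∈ Metric.ball (1:ℝ) δ := Metric.mem_ball_self hδ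
  have hd1 : HasDerivAt (fun s => ∫ t in Set.Ioi (0:ℝ), h1 lamP m a lamr s t)
        (∫ t in Set.Ioi (0:ℝ), h2 lamP m a lamr 1 t) 1 := by
    refine (hasDerivAt_integral_of_dominated_loc_of_deriv_le
      (Metric.isOpen_ball.mem_nhds h1m) ?_ ?_ ?_ ?_ hbi ?_).2
    · exact Filter.Eventually.of_forall fun y => (h_cont lamP m a lamr y).2.1.aestronglyMeasurable
    · exact hint _ (h_cont lamP m a lamr 1).2.1 fun t ht => (hK 1 h1m t ht).2.1
    · exact (h_cont lamP m a lamr 1).2.2.aestronglyMeasurable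
    · exact (ae_restrict_iff' measurableSet_Ioi).2
        (Filter.Eventually.of_forall fun t ht y hy => (hK y hy t ht).2.2)
    · exact (ae_restrict_iff' measurableSet_Ioi).2
        (Filter.Eventually.of_forall fun t ht y _ => h1_deriv y t ha hm ht)
  rw [hΦ]
  refine ⟨(hd0 1 h1m).differentiableAt, ?_⟩
  have hval : (∫ t in Set.Ioi (0 : ℝ),
          ((kappa lamP m a (t / 2) 1) ^ 2 + kappa lamP m a (t / 2) 2)
            * (4 * lamr ^ 2 * t * Real.exp (-2 * lamr * t)))
      = ∫ t in Set.Ioi (0:ℝ), h2 lamP m a lamr 1 t := by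
    apply setIntegral_congr_fun measurableSet_Ioi
    intro t ht
    have ht' : (0:ℝ) ≤ t / 2 := div_nonneg (le_of_lt ht) (by norm_num)
    have hg : gE lamP m a 1 t = 0 := by
      simp [gE, gG]
    simp only [h2, hg, gG_one (lamP := lamP) (m := m) _ ha ht', wW, Real.exp_zero, mul_one]
  rw [hval]
  refine hd1.congr_of_eventuallyEq ?_
  filter_upwards [Metric.isOpen_ball.mem_nhds h1m] with s hs
  exact (hd0 s hs).deriv
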